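/- For every ε > 0 there exists a voting instance and a (3/4 − ε)-sorted ranking π in it such that π is not absolutely popular; hence the constant 3/4 in the sufficient condition for absolute popularity is optimal. -/

import Mathlib

/-- A ranking of `m` candidates: a permutation assigning each candidate its position. -/
abbrev Ranking (m : ℕ) := Equiv.Perm (Fin m)

/-- The Kendall distance: number of unordered pairs of candidates on whose
relative order the two rankings disagree. -/
def kendall {m : ℕ} (π σ : Ranking m) : ℕ :=
  ((Finset.univ : Finset (Fin m × Fin m)).filter
    (fun p => p.1 < p.2 ∧ ¬ ((π p.1 < π p.2) ↔ (σ p.1 < σ p.2)))).card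

/-- Number of voters who strictly prefer `σ` to `π`. -/
def prefCount {m n : ℕ} (prof : Fin n → Ranking m) (σ π : Ranking m) : ℕ :=
  (Finset.univ.filter (fun v => kendall σ (prof v) < kendall π (prof v))).card

/-- `π` is absolutely popular: no ranking is preferred by a strict majority of all voters. -/
def absPop {m n : ℕ} (prof : Fin n → Ranking m) (π : Ranking m) : Prop :=
  ∀ σ : Ranking m, ¬ (2 * prefCount prof σ π > n)

/-- `π` is simply popular: no ranking is preferred by strictly more voters than prefer `π`. -/
def simPop {m n : ℕ} (prof : Fin n → Ranking m) (π : Ranking m) : Prop :=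
  ∀ σ : Ranking m, ¬ (prefCount prof σ π > prefCount prof π σ)

/-- Strict majority of the voters rank `a` before `b`. -/
def maj {m n : ℕ} (prof : Fin n → Ranking m) (a b : Fin m) : Prop :=
  2 * (Finset.univ.filter (fun v => prof v a < prof v b)).card > n

/-- `π` is topologically sorted: it ranks `a` before `b` whenever a strict
majority of voters does. -/
def topSorted {m n : ℕ} (prof : Fin n → Ranking m) (π : Ranking m) : Prop :=
  ∀ a b : Fin m, maj prof a b → π a < π b

/-- `σ` is obtained from `π` by a single swap of candidates occupying adjacent positions. -/
def adjSwap {m : ℕ} (π σ : Ranking m) : Prop :=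
  ∃ i j : Fin m, (i : ℕ) + 1 = (j : ℕ) ∧ σ = π.trans (Equiv.swap i j)

/-- A directed relation is acyclic: no directed cycle. -/
def acyclicRel {α : Type*} (r : α → α → Prop) : Prop :=
  ∀ a, ¬ Relation.TransGen r a a

/-- Sorting key for the ranking in which the candidates `d.succ` with `d ∈ T` come first,
then candidate `0`, then the remaining candidates, each group in increasing order. -/
def promoteKey {k : ℕ} (T : Finset (Fin k)) : Fin (k + 1) → ℕ :=
  Fin.cases k (fun d => if d ∈ T then (d : ℕ) else k + 1 + d)

theorem promoteKey_injective {k : ℕ} (T : Finset (Fin k)) :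
    Function.Injective (promoteKey T) := by
  intro a b h
  induction a using Fin.cases <;> induction b using Fin.cases <;>
    simp only [promoteKey, Fin.cases_zero, Fin.cases_succ] at h <;> grind

/-- The ranking that moves the candidates `d.succ` with `d ∈ T` in front of all others. -/
def promote {k : ℕ} (T : Finset (Fin k)) : Ranking (k + 1) :=
  (Tuple.sort (promoteKey T))⁻¹

theorem promote_lt_iff {k : ℕ} (T : Finset (Fin k)) (a b : Fin (k + 1)) :
    promote T a < promote T b ↔ promoteKey T a < promoteKey T b := by
  have hmono : StrictMono (promoteKey T ∘ Tuple.sort (promoteKey T)) :=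
    (Tuple.monotone_sort (promoteKey T)).strictMono_of_injective
      ((promoteKey_injective T).comp (Equiv.injective _))
  simpa [promote] using (hmono.lt_iff_lt (a := promote T a) (b := promote T b)).symm

theorem promote_zero_lt_succ {k : ℕ} (T : Finset (Fin k)) (d : Fin k) :
    promote T 0 < promote T d.succ ↔ d ∉ T := by
  simp only [promote_lt_iff, promoteKey, Fin.cases_zero, Fin.cases_succ]
  grind

theorem promote_succ_lt_succ {k : ℕ} (T : Finset (Fin k)) {d e : Fin k} (h : d < e) :
    promote T d.succ < promote T e.succ ↔ (e ∈ T → d ∈ T) := by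
  simp only [promote_lt_iff, promoteKey, Fin.cases_succ]
  grind

theorem promote_empty_lt_iff {k : ℕ} (a b : Fin (k + 1)) :
    promote (∅ : Finset (Fin k)) a < promote ∅ b ↔ a < b := by
  rw [promote_lt_iff]
  induction a using Fin.cases <;> induction b using Fin.cases <;>
    simp [promoteKey] <;> grind

theorem promote_lt_of_notMem {k : ℕ} (T : Finset (Fin k)) {a : Fin (k + 1)} {e : Fin k}
    (h : a < e.succ) (he : e ∉ T) : promote T a < promote T e.succ := by
  induction a using Fin.cases with
  | zero => exact (promote_zero_lt_succ T e).2 he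
  | succ d => exact (promote_succ_lt_succ T (Fin.succ_lt_succ_iff.1 h)).2 (absurd · he)

theorem kendall_succ {k : ℕ} (π σ : Ranking (k + 1)) :
    kendall π σ =
      (Finset.univ.filter fun e : Fin k =>
        ¬ ((π 0 < π e.succ) ↔ (σ 0 < σ e.succ))).card +
      ((Finset.univ : Finset (Fin k × Fin k)).filter fun p =>
        p.1 < p.2 ∧ ¬ ((π p.1.succ < π p.2.succ) ↔ (σ p.1.succ < σ p.2.succ))).card := by
  simp only [kendall, Finset.card_filter, Fintype.sum_prod_type, Fin.sum_univ_succ]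
  simp

theorem kendall_promote_univ_lt {k : ℕ} (T : Finset (Fin k)) (h : k < 2 * T.card) :
    kendall (promote Finset.univ) (promote T) < kendall (promote ∅) (promote T) := by
  rw [kendall_succ, kendall_succ]
  have htail : ∀ p : Fin k × Fin k,
      (p.1 < p.2 ∧ ¬ ((promote Finset.univ p.1.succ < promote Finset.univ p.2.succ) ↔
        (promote T p.1.succ < promote T p.2.succ))) ↔
      (p.1 < p.2 ∧ ¬ ((promote ∅ p.1.succ < promote ∅ p.2.succ) ↔
        (promote T p.1.succ < promote T p.2.succ))) := by
    refine fun p => and_congr_right fun hp => ?_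
    simp [promote_succ_lt_succ _ hp]
  simp only [htail]
  gcongr 1
  simp only [promote_zero_lt_succ]
  have hcompl := Finset.card_compl T
  rw [Fintype.card_fin] at hcompl
  simp only [Finset.mem_univ, Finset.notMem_empty, not_true_eq_false, not_false_eq_true,
    false_iff, true_iff, not_not, Finset.filter_univ_mem, Finset.filter_notMem_eq_sdiff]
  rw [← Finset.compl_eq_univ_sdiff]
  omega

/-- The cyclic translate by `-v` of the initial segment of length `t + 1` of `Fin (2 * t + 1)`. -/
def cyclicBlock (t : ℕ) (v : Fin (2 * t + 1)) : Finset (Fin (2 * t + 1)) :=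
  Finset.univ.filter fun d => ((d + v : Fin (2 * t + 1)) : ℕ) < t + 1

theorem card_cyclicBlock (t : ℕ) (v : Fin (2 * t + 1)) : (cyclicBlock t v).card = t + 1 := by
  have h := Finset.card_equiv (s := cyclicBlock t v)
    (t := Finset.univ.filter fun d : Fin (2 * t + 1) => (d : ℕ) < t + 1)
    (Equiv.addRight v) (by simp [cyclicBlock])
  rw [h, Fin.card_filter_val_lt]
  omega

theorem mem_cyclicBlock_comm {t : ℕ} {d v : Fin (2 * t + 1)} :
    d ∈ cyclicBlock t v ↔ v ∈ cyclicBlock t d := by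
  simp [cyclicBlock, add_comm]

/-- One voter promoting each cyclic block, and `2 * t` voters promoting nobody. -/
def cyclicProfile (t : ℕ) : Fin (2 * t + 1 + 2 * t) → Ranking (2 * t + 1 + 1) :=
  Fin.append (fun v => promote (cyclicBlock t v)) (fun _ => promote ∅)

theorem three_mul_le_card_cyclicProfile_lt (t : ℕ) {a b : Fin (2 * t + 1 + 1)} (h : a < b) :
    3 * t ≤ (Finset.univ.filter fun v => cyclicProfile t v a < cyclicProfile t v b).card := by
  induction b using Fin.cases with
  | zero => simp at h
  | succ e =>
    rw [Finset.card_filter, Fin.sum_univ_add]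
    simp only [cyclicProfile, Fin.append_left, Fin.append_right, promote_empty_lt_iff, h,
      if_true, ← Finset.card_filter]
    have hsub : (cyclicBlock t e)ᶜ ⊆ Finset.univ.filter fun v =>
        promote (cyclicBlock t v) a < promote (cyclicBlock t v) e.succ := by
      intro v hv
      rw [Finset.mem_compl, mem_cyclicBlock_comm] at hv
      simpa using promote_lt_of_notMem _ h hv
    have hcard := Finset.card_le_card hsub
    rw [Finset.card_compl, card_cyclicBlock, Fintype.card_fin] at hcard
    simp only [Finset.sum_const, Finset.card_univ, Fintype.card_fin, smul_eq_mul]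
    omega

theorem not_absPop_cyclicProfile (t : ℕ) : ¬ absPop (cyclicProfile t) (promote ∅) := by
  refine fun hpop => hpop (promote Finset.univ) ?_
  have hpref (v : Fin (2 * t + 1)) :
      kendall (promote Finset.univ) (promote (cyclicBlock t v)) <
        kendall (promote ∅) (promote (cyclicBlock t v)) :=
    kendall_promote_univ_lt _ (by rw [card_cyclicBlock]; omega)
  rw [prefCount, Finset.card_filter, Fin.sum_univ_add]
  simp only [cyclicProfile, Fin.append_left, hpref, if_true, Finset.sum_const,
    Finset.card_univ, Fintype.card_fin, smul_eq_mul]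
  omega

theorem three_quarters_tight :
    ∀ ε : ℝ, 0 < ε →
      ∃ (n m : ℕ) (prof : Fin n → Ranking m) (π : Ranking m),
        (∀ a b : Fin m, π a < π b →
          ((Finset.univ.filter (fun v => prof v a < prof v b)).card : ℝ) ≥
            (3 / 4 - ε) * n) ∧
        ¬ absPop prof π := by
  intro ε hε
  obtain ⟨t, ht⟩ := exists_nat_gt (1 / ε)
  refine ⟨_, _, cyclicProfile t, promote ∅, fun a b hab => ?_, not_absPop_cyclicProfile t⟩
  have hcard := three_mul_le_card_cyclicProfile_lt t ((promote_empty_lt_iff a b).1 hab)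
  have hcast : (3 * t : ℝ) ≤
      (Finset.univ.filter fun v => cyclicProfile t v a < cyclicProfile t v b).card := by
    exact_mod_cast hcard
  rw [div_lt_iff₀ hε] at ht
  push_cast
  nlinarith
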